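/- For every s ∈ ℂ that is not a positive integer, L(s, χ₅) = W(s)·L(1−s, χ₅), where W(s) = 5^{1/2−s}·2·(2π)^{s−1}·Γ(1−s)·sin(πs/2); that is, the Dirichlet L-function of the quadratic character mod 5 satisfies the same Riemann-type functional equation as f₀(s) = (1 + 5^{1/2−s})·ζ(s). -/

import Mathlib

open Complex

local instance : Fact (Nat.Prime 5) := ⟨by norm_num⟩

/-- The quadratic Dirichlet character modulo 5 (the unique real nonprincipal
character mod 5, with values `χ₅ 1 = χ₅ 4 = 1` and `χ₅ 2 = χ₅ 3 = -1`). -/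
noncomputable def chi5 : DirichletCharacter ℂ 5 :=
  (quadraticChar (ZMod 5)).ringHomComp (Int.castRingHom ℂ)

/-- `f₀ s = (1 + 5^(1/2 - s)) ζ(s)`. -/
noncomputable def f0 (s : ℂ) : ℂ :=
  (1 + (5 : ℂ) ^ ((1 : ℂ) / 2 - s)) * riemannZeta s

/-- `f₁ s = L(s, χ₅)`, the (entire) Dirichlet L-function of `χ₅`. -/
noncomputable def f1 (s : ℂ) : ℂ := DirichletCharacter.LFunction chi5 s

/-- `W s = 5^(1/2-s) · 2 · (2π)^(s-1) · Γ(1-s) · sin(πs/2)`. -/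
noncomputable def W (s : ℂ) : ℂ :=
  (5 : ℂ) ^ ((1 : ℂ) / 2 - s) * 2 * (2 * (Real.pi : ℂ)) ^ (s - 1) *
    Complex.Gamma (1 - s) * Complex.sin ((Real.pi : ℂ) * s / 2)

/-- `φ_τ s = (1 - τ) f₀ s + τ f₁ s`. -/
noncomputable def phi (τ : ℝ) (s : ℂ) : ℂ := (1 - (τ : ℂ)) * f0 s + (τ : ℂ) * f1 s

lemma chi5_apply (a : ZMod 5) : chi5 a = (quadraticChar (ZMod 5) a : ℂ) := by
  simp [chi5, MulChar.ringHomComp_apply]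

lemma quadraticChar_zmod_five :
    quadraticChar (ZMod 5) 0 = 0 ∧ quadraticChar (ZMod 5) 1 = 1 ∧
    quadraticChar (ZMod 5) 2 = -1 ∧ quadraticChar (ZMod 5) 3 = -1 ∧
    quadraticChar (ZMod 5) 4 = 1 := by
  decide

lemma chi5_ne_one : chi5 ≠ 1 := by
  intro h
  have h2 : chi5 2 = 1 := by
    rw [h, MulChar.one_apply (by decide)]
  rw [chi5_apply, quadraticChar_zmod_five.2.2.1] at h2
  norm_num at h2

lemma chi5_even : chi5.Even := by
  change chi5 4 = 1
  rw [chi5_apply, quadraticChar_zmod_five.2.2.2.2]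
  norm_num

lemma chi5_isPrimitive : chi5.IsPrimitive := by
  rw [DirichletCharacter.isPrimitive_def]
  refine ((Nat.dvd_prime (by norm_num)).mp chi5.conductor_dvd_level).resolve_left fun h ↦ ?_
  exact chi5_ne_one (DirichletCharacter.eq_one_iff_conductor_eq_one.mpr h)

lemma chi5_inv : chi5⁻¹ = chi5 :=
  ((quadraticChar_isQuadratic (ZMod 5)).comp _).inv

lemma gaussSum_chi5 : gaussSum chi5 ZMod.stdAddChar = (5 : ℂ) ^ (1 / 2 : ℂ) := by
  have hcos : 4 * Real.cos (Real.pi / 5) ^ 2 = 2 * Real.cos (Real.pi / 5) + 1 := by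
    rw [Real.cos_pi_div_five]
    nlinarith [Real.sq_sqrt (show (0 : ℝ) ≤ 5 by norm_num)]
  have hreal : 2 * Real.cos (2 * (Real.pi / 5)) + 2 * Real.cos (Real.pi / 5) = √5 := by
    rw [Real.cos_two_mul]
    have := Real.cos_pi_div_five
    linarith
  have hcpow : (5 : ℂ) ^ (1 / 2 : ℂ) = ((√5 : ℝ) : ℂ) := by
    rw [Real.sqrt_eq_rpow, Complex.ofReal_cpow (by norm_num)]
    norm_num
  have hexp (j : ℤ) : ZMod.stdAddChar ((j : ℤ) : ZMod 5) =
      exp (2 * j * (Real.pi / 5) * I) := by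
    rw [ZMod.stdAddChar_coe]
    congr 1
    push_cast
    ring
  have hpair (j : ℤ) : ZMod.stdAddChar ((j : ℤ) : ZMod 5) + ZMod.stdAddChar ((-j : ℤ) : ZMod 5) =
      2 * cos (2 * j * (Real.pi / 5)) := by
    rw [hexp, hexp, two_cos]
    push_cast
    ring_nf
  have h1 := hpair 1
  have h2 := hpair 2
  have hcos4 : cos (2 * (2 : ℤ) * (Real.pi / 5)) = -cos (Real.pi / 5) := by
    rw [← Complex.cos_pi_sub]
    push_cast
    ring_nf
  rw [hcos4] at h2
  rw [show ((-1 : ℤ) : ZMod 5) = 4 from rfl, show ((1 : ℤ) : ZMod 5) = 1 from rfl] at h1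
  rw [show ((-2 : ℤ) : ZMod 5) = 3 from rfl, show ((2 : ℤ) : ZMod 5) = 2 from rfl] at h2
  obtain ⟨v0, v1, v2, v3, v4⟩ := quadraticChar_zmod_five
  have hsum : gaussSum chi5 ZMod.stdAddChar =
      chi5 0 * ZMod.stdAddChar (0 : ZMod 5) + chi5 1 * ZMod.stdAddChar (1 : ZMod 5) +
      chi5 2 * ZMod.stdAddChar (2 : ZMod 5) + chi5 3 * ZMod.stdAddChar (3 : ZMod 5) +
      chi5 4 * ZMod.stdAddChar (4 : ZMod 5) :=
    Fin.sum_univ_five (fun a : ZMod 5 ↦ chi5 a * ZMod.stdAddChar a)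
  rw [hsum, hcpow, ← hreal]
  simp only [chi5_apply, v0, v1, v2, v3, v4]
  push_cast at h1 ⊢
  rw [mul_one] at h1
  linear_combination h1 - h2

lemma rootNumber_chi5 : DirichletCharacter.rootNumber chi5 = 1 := by
  rw [DirichletCharacter.rootNumber, if_pos chi5_even, pow_zero, div_one, gaussSum_chi5]
  push_cast
  exact div_self (by simp [Complex.cpow_eq_zero_iff])

/-- The Dirichlet L-function of the quadratic character mod 5 satisfies the same
Riemann-type functional equation as `f₀`: `L(s, χ₅) = W s · L(1-s, χ₅)` for
every `s` that is not a positive integer. -/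
theorem stmt6 (s : ℂ) (hs : ∀ n : ℕ, 0 < n → s ≠ (n : ℂ)) :
    f1 s = W s * f1 (1 - s) := by
  have ht (n : ℕ) : 1 - s ≠ -n := fun h ↦ hs (n + 1) n.succ_pos (by
    push_cast
    linear_combination -h)
  have hfe := chi5_isPrimitive.completedLFunction_one_sub (1 - s)
  rw [sub_sub_cancel, chi5_inv, rootNumber_chi5, mul_one] at hfe
  have hΓ := inv_Gammaℝ_one_sub ht
  rw [sub_sub_cancel, show (Real.pi : ℂ) * (1 - s) / 2 = Real.pi / 2 - Real.pi * s / 2 by ring,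
    Complex.cos_pi_div_two_sub, Gammaℂ_def, neg_sub] at hΓ
  rw [f1, f1, W, chi5.LFunction_eq_completed_div_gammaFactor s (.inr (by norm_num)),
    chi5.LFunction_eq_completed_div_gammaFactor (1 - s) (.inr (by norm_num)),
    chi5_even.gammaFactor_def, chi5_even.gammaFactor_def, div_eq_mul_inv, hΓ, hfe,
    show 1 - s - 1 / 2 = 1 / 2 - s by ring, div_eq_mul_inv]
  push_cast
  ring
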